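/- The bracket given in the paper's table (5.3) for the dual algebra g*_{DJR}(η), on the 8-dimensional space with basis X₁₁, X₂₂, X₃₃, X₁₂, X₂₁, X₁₃, X₃₁, X₂₃, X₃₂ subject to X₁₁+X₂₂+X₃₃ = 0 — namely [X₁₁,X₁₂] = (1−η)X₁₂, [X₁₁,X₂₁] = (1+η)X₂₁, [X₁₁,X₁₃] = (1+η)X₁₃, [X₁₁,X₃₁] = (1−η)X₃₁, [X₁₁,X₂₃] = 2ηX₂₃, [X₁₁,X₃₂] = −2ηX₃₂, [X₂₂,X₁₂] = −(1+η)X₁₂, [X₂₂,X₂₁] = −(1−η)X₂₁, [X₂₂,X₁₃] = −2ηX₁₃, [X₂₂,X₃₁] = 2ηX₃₁, [X₂₂,X₂₃] = (1−η)X₂₃, [X₂₂,X₃₂] = (1+η)X₃₂, [X₃₃,X₁₂] = 2ηX₁₂, [X₃₃,X₂₁] = −2ηX₂₁, [X₃₃,X₁₃] = −(1−η)X₁₃, [X₃₃,X₃₁] = −(1+η)X₃₁, [X₃₃,X₂₃] = −(1+η)X₂₃, [X₃₃,X₃₂] = −(1−η)X₃₂, [X₁₂,X₂₃] = 2X₁₃,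 [X₂₁,X₃₂] = 2X₃₁, all other brackets of basis elements zero — satisfies the Jacobi identity for every real η, hence defines a Lie algebra. -/

import Mathlib

noncomputable section

/-- Antisymmetrized coordinate product. -/
def dd (x y : Fin 8 → ℝ) (i j : Fin 8) : ℝ := x i * y j - y i * x j

/-- The bracket μ*_{DJR}(η) of table (5.3), on coordinates ordered as
X₁₁, X₂₂, X₁₂, X₂₁, X₁₃, X₃₁, X₂₃, X₃₂ (with X₃₃ = −X₁₁ − X₂₂). -/
def brDJR (η : ℝ) (x y : Fin 8 → ℝ) : Fin 8 → ℝ :=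
  ![0, 0,
    (1 - η) * dd x y 0 2 - (1 + η) * dd x y 1 2,
    (1 + η) * dd x y 0 3 - (1 - η) * dd x y 1 3,
    (1 + η) * dd x y 0 4 - 2 * η * dd x y 1 4 + 2 * dd x y 2 6,
    (1 - η) * dd x y 0 5 + 2 * η * dd x y 1 5 + 2 * dd x y 3 7,
    2 * η * dd x y 0 6 + (1 - η) * dd x y 1 6,
    -2 * η * dd x y 0 7 + (1 + η) * dd x y 1 7]

/-- the bracket μ*_{DJR}(η) satisfies the Jacobi identity for every real η. -/
theorem stmt8 (η : ℝ) :
    ∀ x y z : Fin 8 → ℝ,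
      brDJR η (brDJR η x y) z + brDJR η (brDJR η y z) x + brDJR η (brDJR η z x) y = 0 := by
  intro x y z
  have e0 : ∀ u v, brDJR η u v 0 = 0 := fun _ _ => rfl
  have e1 : ∀ u v, brDJR η u v 1 = 0 := fun _ _ => rfl
  have e2 : ∀ u v, brDJR η u v 2 = (1 - η) * dd u v 0 2 - (1 + η) * dd u v 1 2 :=
    fun _ _ => rfl
  have e3 : ∀ u v, brDJR η u v 3 = (1 + η) * dd u v 0 3 - (1 - η) * dd u v 1 3 :=
    fun _ _ => rfl
  have e4 : ∀ u v, brDJR η u v 4 =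
      (1 + η) * dd u v 0 4 - 2 * η * dd u v 1 4 + 2 * dd u v 2 6 := fun _ _ => rfl
  have e5 : ∀ u v, brDJR η u v 5 =
      (1 - η) * dd u v 0 5 + 2 * η * dd u v 1 5 + 2 * dd u v 3 7 := fun _ _ => rfl
  have e6 : ∀ u v, brDJR η u v 6 = 2 * η * dd u v 0 6 + (1 - η) * dd u v 1 6 :=
    fun _ _ => rfl
  have e7 : ∀ u v, brDJR η u v 7 = -2 * η * dd u v 0 7 + (1 + η) * dd u v 1 7 :=
    fun _ _ => rfl
  funext i
  simp only [Pi.add_apply, Pi.zero_apply]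
  revert i
  simp only [Fin.forall_fin_succ, Fin.forall_fin_zero_pi, IsEmpty.forall_iff, and_true]
  refine ⟨?_, ?_, ?_, ?_, ?_, ?_, ?_, ?_⟩
  · change brDJR η _ _ 0 + brDJR η _ _ 0 + brDJR η _ _ 0 = 0
    simp only [e0]; ring
  · change brDJR η _ _ 1 + brDJR η _ _ 1 + brDJR η _ _ 1 = 0
    simp only [e0, e1, e2, e3, e4, e5, e6, e7, dd]; ring
  · change brDJR η _ _ 2 + brDJR η _ _ 2 + brDJR η _ _ 2 = 0
    simp only [e0, e1, e2, e3, e4, e5, e6, e7, dd]; ring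
  · change brDJR η _ _ 3 + brDJR η _ _ 3 + brDJR η _ _ 3 = 0
    simp only [e0, e1, e2, e3, e4, e5, e6, e7, dd]; ring
  · change brDJR η _ _ 4 + brDJR η _ _ 4 + brDJR η _ _ 4 = 0
    simp only [e0, e1, e2, e3, e4, e5, e6, e7, dd]; ring
  · change brDJR η _ _ 5 + brDJR η _ _ 5 + brDJR η _ _ 5 = 0
    simp only [e0, e1, e2, e3, e4, e5, e6, e7, dd]; ring
  · change brDJR η _ _ 6 + brDJR η _ _ 6 + brDJR η _ _ 6 = 0
    simp only [e0, e1, e2, e3, e4, e5, e6, e7, dd]; ring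
  · change brDJR η _ _ 7 + brDJR η _ _ 7 + brDJR η _ _ 7 = 0
    simp only [e0, e1, e2, e3, e4, e5, e6, e7, dd]; ring
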